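/- Let G and H be finitely generated groups with finite generating sets S and T respectively. Then the Cayley graph of the free product G*H with respect to the generating set S ∪ T is a tree-graded space with respect to the collection of all left cosets w·G and w·H (w ∈ G*H), regarded as subsets (subgraphs) of the Cayley graph. -/

import Mathlib

open Set Metric

section Core

variable {X : Type*} [MetricSpace X]

/-- A geodesic segment parametrized by the interval `[a, b]`:
an isometric embedding of `[a, b]` into `X`. -/
def IsGeodesicSegment (γ : ℝ → X) (a b : ℝ) : Prop :=
  ∀ s ∈ Set.Icc a b, ∀ t ∈ Set.Icc a b, dist (γ s) (γ t) = |s - t|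

/-- A metric space is geodesic if every two points are joined by a geodesic. -/
def GeodesicSpace (X : Type*) [MetricSpace X] : Prop :=
  ∀ x y : X, ∃ γ : ℝ → X, IsGeodesicSegment γ 0 (dist x y) ∧ γ 0 = x ∧ γ (dist x y) = y

/-- A subset is geodesic if every two of its points are joined by a geodesic of `X`
contained in the subset. -/
def IsGeodesicSubset (S : Set X) : Prop :=
  ∀ x ∈ S, ∀ y ∈ S, ∃ γ : ℝ → X, IsGeodesicSegment γ 0 (dist x y) ∧ γ 0 = x ∧
    γ (dist x y) = y ∧ ∀ t ∈ Set.Icc (0 : ℝ) (dist x y), γ t ∈ S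

/-- A (complete geodesic) metric space is tree-graded with respect to a collection `PX`
of closed geodesic subsets (pieces) covering `X` if every two different pieces meet in
at most one point (T₁) and every simple loop (injective continuous image of a circle)
is contained in one piece (T₂''). -/
structure IsTreeGraded (X : Type*) [MetricSpace X] (PX : Set (Set X)) : Prop where
  nonempty : ∀ P ∈ PX, P.Nonempty
  closed : ∀ P ∈ PX, IsClosed P
  geodesicSub : ∀ P ∈ PX, IsGeodesicSubset P
  covers : ∀ x : X, ∃ P ∈ PX, x ∈ P
  t1 : ∀ P ∈ PX, ∀ Q ∈ PX, P ≠ Q → (P ∩ Q).Subsingleton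
  t2 : ∀ loop : AddCircle (1 : ℝ) → X, Continuous loop → Function.Injective loop →
    ∃ P ∈ PX, Set.range loop ⊆ P

end Core
section Chains

variable {Y : Type*}

/-- An `r`-chain from `x` to `y` inside the set `S`, with respect to the distance
function `d`: a finite sequence `x = c 0, c 1, …, c m = y` of points of `S` with
consecutive distances `< r`. -/
def IsDChain (d : Y → Y → ℝ) (r : ℝ) (S : Set Y) (x y : Y) : Prop :=
  ∃ (m : ℕ) (c : ℕ → Y), c 0 = x ∧ c m = y ∧ (∀ i ≤ m, c i ∈ S) ∧
    ∀ i < m, d (c i) (c (i + 1)) < r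

/-- A set is `r`-scale connected if every two of its points are joined by an
`r`-chain contained in it. -/
def DScaleConnected (d : Y → Y → ℝ) (r : ℝ) (S : Set Y) : Prop :=
  ∀ x ∈ S, ∀ y ∈ S, IsDChain d r S x y

/-- `C` is an `r`-scale connected component of `U`: a maximal `r`-scale connected
subset of `U`. -/
def IsDComponent (d : Y → Y → ℝ) (r : ℝ) (U C : Set Y) : Prop :=
  C ⊆ U ∧ DScaleConnected d r C ∧
    ∀ C', C ⊆ C' → C' ⊆ U → DScaleConnected d r C' → C = C'

/-- A set is `M`-bounded: its diameter is at most `M`. -/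
def DBounded (d : Y → Y → ℝ) (M : ℝ) (S : Set Y) : Prop :=
  ∀ x ∈ S, ∀ y ∈ S, d x y ≤ M

/-- A space has dimension `≤ n` at scale `s` of magnitude `M` if there is a cover by
`n + 1` sets such that every `s`-scale connected component of each of them is
`M`-bounded. -/
def DimLeAtScale (d : Y → Y → ℝ) (n : ℕ) (s M : ℝ) : Prop :=
  ∃ U : Fin (n + 1) → Set Y, (∀ y, ∃ i, y ∈ U i) ∧
    ∀ i C, IsDComponent d s (U i) C → DBounded d M C

end Chains
section WordMetric

variable {G : Type*} [Group G]

/-- The word length of `g` with respect to the generating set `S`: the least number of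
factors from `S ∪ S⁻¹` needed to write `g`. -/
noncomputable def wordLength (S : Set G) (g : G) : ℕ :=
  sInf {m : ℕ | ∃ l : List G, l.length = m ∧ (∀ x ∈ l, x ∈ S ∨ x⁻¹ ∈ S) ∧ l.prod = g}

/-- The word metric on `G` associated with the generating set `S`. -/
noncomputable def wordDist (S : Set G) (g h : G) : ℝ :=
  (wordLength S (g⁻¹ * h) : ℝ)

end WordMetric

section ANdim

variable {Y : Type*}

/-- `f` is an `n`-dimensional control function: for every scale `s > 0` the space has
dimension `≤ n` at scale `s` of magnitude `f s`. -/
def IsControlFunction (d : Y → Y → ℝ) (n : ℕ) (f : ℝ → ℝ) : Prop :=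
  ∀ s : ℝ, 0 < s → DimLeAtScale d n s (f s)

/-- Asymptotic Assouad–Nagata dimension is at most `n`: there is a linear
`n`-dimensional control function. -/
def ANdimLe (d : Y → Y → ℝ) (n : ℕ) : Prop :=
  ∃ C b : ℝ, 0 < C ∧ 0 < b ∧ IsControlFunction d n (fun s => C * s + b)

/-- The asymptotic Assouad–Nagata dimension: the least `n` admitting a linear
`n`-dimensional control function (`⊤` if there is none). -/
noncomputable def asdimAN (d : Y → Y → ℝ) : ℕ∞ :=
  sInf {N : ℕ∞ | ∃ n : ℕ, N = (n : ℕ∞) ∧ ANdimLe d n}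

end ANdim
open Pointwise

section Cayley

variable {X : Type*} [MetricSpace X]

/-- The union of all geodesics between `x` and `y`: the points lying metrically
between `x` and `y`. -/
def segBetween (x y : X) : Set X :=
  {z : X | dist x z + dist z y = dist x y}

/-- The realization, inside the Cayley graph `X` with vertex map `ι`, of the full
subgraph spanned by a set `C` of group elements: the vertices of `C` together with all
edges (unit segments) joining two adjacent elements of `C`. -/
def cosetPiece {W : Type*} (ι : W → X) (dW : W → W → ℝ) (C : Set W) : Set X :=
  (ι '' C) ∪ {x : X | ∃ u ∈ C, ∃ v ∈ C, dW u v = 1 ∧ x ∈ segBetween (ι u) (ι v)}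

end Cayley

section SideFunction

variable {W : Type*} [Group W]

/-- A colouring of a group generated by two subgroups such that, away from the identity, the
colour is invariant under right multiplication by elements of the two subgroups, and the
nontrivial elements of `K b` have colour `b`. In a free product, the colour of an element records
the factor containing the first letter of its normal form. -/
structure IsSideFunction (K : Bool → Subgroup W) (ε : W → Bool) : Prop where
  eq_of_mem : ∀ b, ∀ k ∈ K b, k ≠ 1 → ε k = b
  mul_right : ∀ b, ∀ k ∈ K b, ∀ x, x ≠ 1 → x * k ≠ 1 → ε (x * k) = ε x
  closure_eq_top : Subgroup.closure (⋃ b, (K b : Set W)) = ⊤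

/-- The left cosets of the subgroups in the family `K`. -/
def IsFactorCoset (K : Bool → Subgroup W) (C : Set W) : Prop :=
  ∃ (w : W) (b : Bool), C = {x | w⁻¹ * x ∈ K b}

/-- The elements lying on side `b` of `w`, together with `w` itself. -/
def sideSet (ε : W → Bool) (w : W) (b : Bool) : Set W :=
  {x | x = w ∨ ε (w⁻¹ * x) = b}

variable {K : Bool → Subgroup W} {ε : W → Bool}

namespace IsSideFunction

theorem eq_of_mem_of_mem (h : IsSideFunction K ε) {b b' : Bool} {k : W} (hk : k ∈ K b)
    (hk' : k ∈ K b') (h1 : k ≠ 1) : b = b' :=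
  (h.eq_of_mem b k hk h1).symm.trans (h.eq_of_mem b' k hk' h1)

theorem mem_of_mul_mem (h : IsSideFunction K ε) {b b' b'' : Bool} {x y : W} (hx : x ∈ K b)
    (hx1 : x ≠ 1) (hy : y ∈ K b') (hxy : x * y ∈ K b'') : y ∈ K b := by
  by_cases hb : b' = b
  · exact hb ▸ hy
  by_cases hxy1 : x * y = 1
  · rw [eq_inv_of_mul_eq_one_right hxy1]
    exact inv_mem hx
  have h2 : b'' = b :=
    (h.eq_of_mem b'' _ hxy hxy1).symm.trans
      ((h.mul_right b' y hy x hx1 hxy1).trans (h.eq_of_mem b x hx hx1))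
  subst h2
  exact (Subgroup.mul_mem_cancel_left _ hx).1 hxy

theorem mem_coset_of_triangle (h : IsSideFunction K ε) {C : Set W} (hC : IsFactorCoset K C)
    {u v t : W} (hu : u ∈ C) (hv : v ∈ C) (huv : u ≠ v) (hut : ∃ b, u⁻¹ * t ∈ K b)
    (hvt : ∃ b, v⁻¹ * t ∈ K b) : t ∈ C := by
  obtain ⟨w, b, rfl⟩ := hC
  obtain ⟨b₁, h₁⟩ := hut
  obtain ⟨b₂, h₂⟩ := hvt
  have huv' : v⁻¹ * u ∈ K b := by
    have := mul_mem (inv_mem (show w⁻¹ * v ∈ K b from hv)) (show w⁻¹ * u ∈ K b from hu)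
    simpa [mul_assoc] using this
  have h1 : v⁻¹ * u ≠ 1 := fun he => huv (inv_mul_eq_one.1 he).symm
  have h3 : (v⁻¹ * u) * (u⁻¹ * t) ∈ K b₂ := by simpa [mul_assoc] using h₂
  have h4 := h.mem_of_mul_mem huv' h1 h₁ h3
  have := mul_mem hu h4
  simpa [mul_assoc] using this

theorem coset_eq (h : IsSideFunction K ε) {C D : Set W} (hC : IsFactorCoset K C)
    (hD : IsFactorCoset K D) {u v : W} (huv : u ≠ v) (huC : u ∈ C) (hvC : v ∈ C)
    (huD : u ∈ D) (hvD : v ∈ D) : C = D := by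
  obtain ⟨w, b, rfl⟩ := hC
  obtain ⟨w', b', rfl⟩ := hD
  have h1 : u⁻¹ * v ≠ 1 := fun he => huv (inv_mul_eq_one.1 he)
  have hb : u⁻¹ * v ∈ K b := by
    have := mul_mem (inv_mem (show w⁻¹ * u ∈ K b from huC)) (show w⁻¹ * v ∈ K b from hvC)
    simpa [mul_assoc] using this
  have hb' : u⁻¹ * v ∈ K b' := by
    have := mul_mem (inv_mem (show w'⁻¹ * u ∈ K b' from huD)) (show w'⁻¹ * v ∈ K b' from hvD)
    simpa [mul_assoc] using this
  obtain rfl := h.eq_of_mem_of_mem hb hb' h1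
  have key : ∀ a x : W, a⁻¹ * u ∈ K b → (a⁻¹ * x ∈ K b ↔ u⁻¹ * x ∈ K b) := fun a x ha => by
    rw [← Subgroup.mul_mem_cancel_left _ ha (y := u⁻¹ * x)]
    simp [mul_assoc]
  ext x
  exact (key w x huC).trans (key w' x huD).symm

theorem exists_sideSet_not (h : IsSideFunction K ε) (b : Bool) (x : W) :
    ∃ k ∈ K b, x ∈ sideSet ε k (!b) := by
  have step : ∀ x : W, ∀ b', ∀ y ∈ K b', (∃ k ∈ K b, x ∈ sideSet ε k (!b)) →
      ∃ k ∈ K b, x * y ∈ sideSet ε k (!b) := by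
    rintro x b' y hy ⟨k, hk, hx⟩
    by_cases hxk : x = k
    · subst hxk
      by_cases hb : b' = b
      · subst hb
        exact ⟨x * y, mul_mem hk hy, Or.inl rfl⟩
      · refine ⟨x, hk, ?_⟩
        by_cases hy1 : y = 1
        · exact Or.inl (by simp [hy1])
        · right
          rw [inv_mul_cancel_left, h.eq_of_mem b' y hy hy1]
          cases b <;> cases b' <;> simp_all
    · refine ⟨k, hk, ?_⟩
      have hx' := hx.resolve_left hxk
      by_cases hxy : x * y = k
      · exact Or.inl hxy
      · right
        rw [← mul_assoc, h.mul_right b' y hy, hx']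
        · exact fun he => hxk (inv_mul_eq_one.1 he).symm
        · rw [mul_assoc]
          exact fun he => hxy (inv_mul_eq_one.1 he).symm
  have hx : x ∈ Subgroup.closure (⋃ b, (K b : Set W)) := h.closure_eq_top ▸ Subgroup.mem_top x
  induction hx using Subgroup.closure_induction_right with
  | one => exact ⟨1, one_mem _, Or.inl rfl⟩
  | mul_right x _ y hy ih =>
    obtain ⟨b', hb'⟩ := mem_iUnion.1 hy
    exact step x b' y hb' ih
  | mul_inv_cancel x _ y hy ih =>
    obtain ⟨b', hb'⟩ := mem_iUnion.1 hy
    exact step x b' y⁻¹ (inv_mem hb') ih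

theorem side_eq (h : IsSideFunction K ε) {w u v : W} (huv : ∃ b, u⁻¹ * v ∈ K b)
    (hu : u ≠ w) (hv : v ≠ w) : ε (w⁻¹ * u) = ε (w⁻¹ * v) := by
  obtain ⟨b, hb⟩ := huv
  have := h.mul_right b _ hb (w⁻¹ * u) (fun he => hu (inv_mul_eq_one.1 he).symm)
    (by simpa [mul_assoc] using fun he => hv (inv_mul_eq_one.1 he).symm)
  rw [← this]
  simp [mul_assoc]

/-- Two adjacent elements, one of which lies outside a coset `C`, are separated from `C` by some
element of `C`. -/
theorem exists_separating (h : IsSideFunction K ε) {C : Set W} (hC : IsFactorCoset K C)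
    {p q : W} (hp : p ∉ C) (hpq : ∃ b, p⁻¹ * q ∈ K b) :
    ∃ w ∈ C, ∃ b, C ⊆ sideSet ε w b ∧ p ∈ sideSet ε w (!b) ∧ q ∈ sideSet ε w (!b) := by
  obtain ⟨w, b, rfl⟩ := hC
  obtain ⟨k, hk, hx⟩ := h.exists_sideSet_not b (w⁻¹ * p)
  have hwk : w * k ∈ {x | w⁻¹ * x ∈ K b} := by simpa using hk
  have hpk : p ≠ w * k := fun he => hp (he ▸ hwk)
  have hx' : ε ((w * k)⁻¹ * p) = !b := by
    rw [mul_inv_rev, mul_assoc]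
    exact hx.resolve_left fun he => hpk (by rw [← he]; simp)
  refine ⟨w * k, hwk, b, fun c hc => ?_, Or.inr hx', ?_⟩
  · by_cases hck : c = w * k
    · exact Or.inl hck
    · right
      refine h.eq_of_mem b _ ?_ (fun he => hck (inv_mul_eq_one.1 he).symm)
      rw [mul_inv_rev, mul_assoc]
      exact mul_mem (inv_mem hk) hc
  · by_cases hq : q = w * k
    · exact Or.inl hq
    · exact Or.inr (by rw [← h.side_eq hpq hpk hq, hx'])

end IsSideFunction

end SideFunction

section CoprodSide

variable (G H : Type*) [Group G] [Group H]

/-- The two factors of a free product. -/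
def coprodFactor : Bool → Subgroup (Monoid.Coprod G H)
  | true => (Monoid.Coprod.inl : G →* Monoid.Coprod G H).range
  | false => (Monoid.Coprod.inr : H →* Monoid.Coprod G H).range

/-- The action of a group on two disjoint copies of itself by left multiplication. -/
def doubleMulLeft (W : Type*) [Group W] : W →* Equiv.Perm (W × Bool) where
  toFun x := (Equiv.mulLeft x).prodCongr (Equiv.refl Bool)
  map_one' := by ext p <;> simp
  map_mul' x y := by ext p <;> simp [mul_assoc]

open Classical in
/-- The action of a free product on two copies of itself in which the first factor acts by left
multiplication and the second one by left multiplication conjugated by the transposition exchanging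
the two copies of the identity. -/
noncomputable def twistedMulLeft :
    Monoid.Coprod G H →* Equiv.Perm (Monoid.Coprod G H × Bool) :=
  Monoid.Coprod.lift ((doubleMulLeft _).comp Monoid.Coprod.inl)
    ((MulAut.conj (Equiv.swap (1, true) (1, false))).toMonoidHom.comp
      ((doubleMulLeft _).comp Monoid.Coprod.inr))

variable {G H}

theorem twistedMulLeft_inl (g : G) (p : Monoid.Coprod G H × Bool) :
    twistedMulLeft G H (Monoid.Coprod.inl g) p = (Monoid.Coprod.inl g * p.1, p.2) := rfl

open Classical in
theorem twistedMulLeft_inr (h : H) (p : Monoid.Coprod G H × Bool) :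
    twistedMulLeft G H (Monoid.Coprod.inr h) p = Equiv.swap (1, true) (1, false)
      (doubleMulLeft _ (Monoid.Coprod.inr h) (Equiv.swap (1, true) (1, false) p)) := by
  simp only [twistedMulLeft, Monoid.Coprod.lift_apply_inr, MonoidHom.comp_apply,
    MulEquiv.toMonoidHom_eq_coe, MonoidHom.coe_coe, MulAut.conj_apply, Equiv.Perm.mul_apply,
    Equiv.swap_inv]

theorem twistedMulLeft_inr_one {h : H} (b : Bool)
    (hh : (Monoid.Coprod.inr h : Monoid.Coprod G H) ≠ 1) :
    twistedMulLeft G H (Monoid.Coprod.inr h) (1, b) = (Monoid.Coprod.inr h, !b) := by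
  classical
  rw [twistedMulLeft_inr]
  cases b <;>
    simpa [doubleMulLeft] using Equiv.swap_apply_of_ne_of_ne (by simp [hh]) (by simp [hh])

theorem twistedMulLeft_inr_of_ne {h : H} {x : Monoid.Coprod G H} (b : Bool) (hx : x ≠ 1)
    (hhx : Monoid.Coprod.inr h * x ≠ 1) :
    twistedMulLeft G H (Monoid.Coprod.inr h) (x, b) = (Monoid.Coprod.inr h * x, b) := by
  classical
  rw [twistedMulLeft_inr, Equiv.swap_apply_of_ne_of_ne (a := (1, true)) (b := (1, false))
    (x := (x, b)) (by simp [hx]) (by simp [hx])]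
  exact Equiv.swap_apply_of_ne_of_ne (by simp [doubleMulLeft, hhx]) (by simp [doubleMulLeft, hhx])

theorem twistedMulLeft_fst (x : Monoid.Coprod G H) (p : Monoid.Coprod G H × Bool) :
    (twistedMulLeft G H x p).1 = x * p.1 := by
  classical
  have hswap : ∀ p : Monoid.Coprod G H × Bool,
      (Equiv.swap ((1 : Monoid.Coprod G H), true) (1, false) p).1 = p.1 := fun p => by
    rw [Equiv.swap_apply_def]
    split_ifs with h1 h2 <;> simp_all
  induction x using Monoid.Coprod.induction_on' generalizing p with
  | one => simp
  | inl_mul m x ih => rw [map_mul, Equiv.Perm.mul_apply, twistedMulLeft_inl, ih, mul_assoc]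
  | inr_mul n x ih =>
    rw [map_mul, Equiv.Perm.mul_apply, mul_assoc, ← ih, twistedMulLeft_inr, hswap]
    simp [doubleMulLeft, hswap]

variable (G H) in
/-- The factor containing the first letter of the normal form of an element of a free product. -/
noncomputable def coprodSide (x : Monoid.Coprod G H) : Bool :=
  (twistedMulLeft G H x⁻¹ (1, true)).2

theorem isSideFunction_coprodSide : IsSideFunction (coprodFactor G H) (coprodSide G H) where
  eq_of_mem := by
    rintro (_ | _) k ⟨y, rfl⟩ h1
    · rw [coprodSide, ← map_inv, twistedMulLeft_inr_one]
      · rfl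
      · rwa [map_inv, ne_eq, inv_eq_one]
    · rw [coprodSide, ← map_inv, twistedMulLeft_inl]
  mul_right := by
    intro b k hk x hx hxk
    have hfst := twistedMulLeft_fst x⁻¹ (1, true)
    rw [mul_one] at hfst
    have hp : twistedMulLeft G H x⁻¹ (1, true) = (x⁻¹, coprodSide G H x) :=
      Prod.ext hfst rfl
    rw [coprodSide, mul_inv_rev, map_mul, Equiv.Perm.mul_apply, hp]
    cases b
    · obtain ⟨y, rfl⟩ := hk
      rw [← map_inv, twistedMulLeft_inr_of_ne _ (inv_ne_one.2 hx)]
      rwa [map_inv, ← mul_inv_rev, inv_ne_one]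
    · obtain ⟨y, rfl⟩ := hk
      rw [← map_inv, twistedMulLeft_inl]
  closure_eq_top := by
    rw [← Subgroup.iSup_eq_closure, iSup_bool_eq]
    exact Monoid.Coprod.range_inl_sup_range_inr

end CoprodSide

section WordLength

variable {W : Type*} [Group W] {A : Set W}

theorem exists_list_length_eq_wordLength (hA : Subgroup.closure A = ⊤) (g : W) :
    ∃ l : List W, l.length = wordLength A g ∧ (∀ x ∈ l, x ∈ A ∨ x⁻¹ ∈ A) ∧ l.prod = g := by
  have hg : g ∈ (Subgroup.closure A).toSubmonoid := hA ▸ Subgroup.mem_top g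
  rw [Subgroup.closure_toSubmonoid] at hg
  obtain ⟨l, hl, hprod⟩ := Submonoid.exists_list_of_mem_closure hg
  exact Nat.sInf_mem (s := {m : ℕ | ∃ l : List W, l.length = m ∧
    (∀ x ∈ l, x ∈ A ∨ x⁻¹ ∈ A) ∧ l.prod = g}) ⟨_, l, rfl, hl, hprod⟩

theorem eq_one_of_wordLength_eq_zero (hA : Subgroup.closure A = ⊤) {g : W}
    (hg : wordLength A g = 0) : g = 1 := by
  obtain ⟨l, hl, -, rfl⟩ := exists_list_length_eq_wordLength hA g
  rw [hg, List.length_eq_zero_iff] at hl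
  simp [hl]

theorem mem_or_inv_mem_of_wordLength_eq_one (hA : Subgroup.closure A = ⊤) {g : W}
    (hg : wordLength A g = 1) : g ∈ A ∨ g⁻¹ ∈ A := by
  obtain ⟨l, hl, hmem, rfl⟩ := exists_list_length_eq_wordLength hA g
  rw [hg, List.length_eq_one_iff] at hl
  obtain ⟨a, rfl⟩ := hl
  simpa using hmem

theorem finite_setOf_wordLength_le (hA : Subgroup.closure A = ⊤) (hfin : A.Finite) (n : ℕ) :
    {g | wordLength A g ≤ n}.Finite := by
  have key : ∀ m : ℕ, {g | ∃ l : List W, l.length = m ∧ (∀ x ∈ l, x ∈ A ∨ x⁻¹ ∈ A) ∧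
      l.prod = g}.Finite := by
    intro m
    induction m with
    | zero =>
      refine (Set.finite_singleton (1 : W)).subset ?_
      rintro _ ⟨l, hl, -, rfl⟩
      simp [List.length_eq_zero_iff.1 hl]
    | succ m ih =>
      refine ((hfin.union hfin.inv).mul ih).subset ?_
      rintro _ ⟨_ | ⟨a, l⟩, hl, hmem, rfl⟩
      · simp at hl
      · rw [List.prod_cons]
        refine Set.mul_mem_mul (by simpa using hmem a (by simp)) ⟨l, by simpa using hl, ?_, rfl⟩
        exact fun x hx => hmem x (by simp [hx])
  refine ((Set.finite_Iic n).biUnion fun m _ => key m).subset fun g hg => ?_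
  exact Set.mem_biUnion hg (exists_list_length_eq_wordLength hA g)

end WordLength

section SpanPiece

variable {W X : Type*} [MetricSpace X]

theorem segBetween_comm (x y : X) : segBetween x y = segBetween y x := by
  ext z
  change dist x z + dist z y = dist x y ↔ dist y z + dist z x = dist y x
  rw [dist_comm y z, dist_comm z x, dist_comm y x, add_comm]

theorem eq_of_mem_segBetween_self {x z : X} (h : z ∈ segBetween x x) : z = x := by
  have h' : dist x z + dist z x = dist x x := h
  rw [dist_self, dist_comm x z] at h'
  exact dist_eq_zero.1 (by linarith)

/-- The full subgraph spanned by a set of vertices. -/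
def spanPiece (ι : W → X) (C : Set W) : Set X :=
  cosetPiece ι (fun u v => dist (ι u) (ι v)) C

variable {ι : W → X}

theorem mem_spanPiece_of_mem {C : Set W} {c : W} (hc : c ∈ C) : ι c ∈ spanPiece ι C :=
  Or.inl ⟨c, hc, rfl⟩

theorem spanPiece_mono {C D : Set W} (h : C ⊆ D) : spanPiece ι C ⊆ spanPiece ι D := by
  rintro x (⟨c, hc, rfl⟩ | ⟨u, hu, v, hv, huv⟩)
  · exact mem_spanPiece_of_mem (h hc)
  · exact Or.inr ⟨u, h hu, v, h hv, huv⟩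

end SpanPiece

section Realization

variable {W X : Type*} [Group W] [MetricSpace X]

/-- A realization of a locally finite graph on the vertex set `W`, whose edges join elements
in the same left coset of some subgroup `K b`. -/
structure IsGraphRealization (K : Bool → Subgroup W) (ι : W → X) : Prop where
  dist_eq_nat : ∀ u v, ∃ n : ℕ, dist (ι u) (ι v) = n
  injective : Function.Injective ι
  mem_of_dist_le : ∀ u v, dist (ι u) (ι v) ≤ 1 → ∃ b, u⁻¹ * v ∈ K b
  finite_ball : ∀ w r, {u | dist (ι w) (ι u) ≤ r}.Finite
  cover : ∀ x : X, ∃ u v, dist (ι u) (ι v) = 1 ∧ x ∈ segBetween (ι u) (ι v)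

variable {K : Bool → Subgroup W} {ε : W → Bool} {ι : W → X}

namespace IsGraphRealization

theorem dist_eq_zero_or_one (hι : IsGraphRealization K ι) {u v : W} (h : dist (ι u) (ι v) ≤ 1) :
    u = v ∨ dist (ι u) (ι v) = 1 := by
  obtain ⟨n, hn⟩ := hι.dist_eq_nat u v
  have hn1 : n ≤ 1 := by exact_mod_cast hn ▸ h
  interval_cases n
  · exact Or.inl (hι.injective (dist_eq_zero.1 (by simpa using hn)))
  · exact Or.inr (by simpa using hn)

theorem mem_spanPiece_iff (hι : IsGraphRealization K ι) {C : Set W} {z : X} :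
    z ∈ spanPiece ι C ↔
      ∃ u ∈ C, ∃ v ∈ C, dist (ι u) (ι v) ≤ 1 ∧ z ∈ segBetween (ι u) (ι v) := by
  constructor
  · rintro (⟨c, hc, rfl⟩ | ⟨u, hu, v, hv, huv, hz⟩)
    · exact ⟨c, hc, c, hc, by simp, by simp [segBetween]⟩
    · exact ⟨u, hu, v, hv, huv.le, hz⟩
  · rintro ⟨u, hu, v, hv, huv, hz⟩
    rcases hι.dist_eq_zero_or_one huv with rfl | h1
    · rw [eq_of_mem_segBetween_self hz]
      exact mem_spanPiece_of_mem hu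
    · exact Or.inr ⟨u, hu, v, hv, h1, hz⟩

theorem isClosed_spanPiece (hι : IsGraphRealization K ι) (C : Set W) :
    IsClosed (spanPiece ι C) := by
  let E : Type _ := {p : W × W // p.1 ∈ C ∧ p.2 ∈ C ∧ dist (ι p.1) (ι p.2) ≤ 1}
  have heq : spanPiece ι C = ⋃ e : E, segBetween (ι e.1.1) (ι e.1.2) := by
    ext z
    rw [hι.mem_spanPiece_iff, mem_iUnion]
    constructor
    · rintro ⟨u, hu, v, hv, huv, hz⟩
      exact ⟨⟨(u, v), hu, hv, huv⟩, hz⟩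
    · rintro ⟨⟨⟨u, v⟩, hu, hv, huv⟩, hz⟩
      exact ⟨u, hu, v, hv, huv, hz⟩
  rw [heq]
  refine LocallyFinite.isClosed_iUnion (fun x => ?_) fun e =>
    isClosed_eq (by fun_prop) continuous_const
  refine ⟨ball x 1, ball_mem_nhds x one_pos, ?_⟩
  obtain ⟨w, -⟩ := hι.cover x
  have hfin := hι.finite_ball w (dist (ι w) x + 2)
  refine Set.Finite.subset ((hfin.prod hfin).preimage Subtype.val_injective.injOn) ?_
  rintro ⟨⟨u, v⟩, hu, hv, huv⟩ ⟨z, hz, hzx⟩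
  have hz' : dist (ι u) z + dist z (ι v) = dist (ι u) (ι v) := hz
  simp only at huv hz'
  rw [mem_ball, dist_comm] at hzx
  have h1 := dist_triangle4 (ι w) x z (ι u)
  have h2 := dist_triangle4 (ι w) x z (ι v)
  have h3 := dist_nonneg (x := ι u) (y := z)
  have h4 := dist_nonneg (x := z) (y := ι v)
  rw [dist_comm z (ι u)] at h1
  exact ⟨show dist (ι w) (ι u) ≤ dist (ι w) x + 2 by linarith,
    show dist (ι w) (ι v) ≤ dist (ι w) x + 2 by linarith⟩

/-- A point lying on two edges, an end point of the first being far from an end point of the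
second, is a common end point of the two edges. -/
theorem eq_of_one_lt_dist (hι : IsGraphRealization K ι) {u v u' v' : W} {z : X}
    (huv : dist (ι u) (ι v) ≤ 1) (huv' : dist (ι u') (ι v') ≤ 1)
    (hz : z ∈ segBetween (ι u) (ι v)) (hz' : z ∈ segBetween (ι u') (ι v'))
    (hfar : 1 < dist (ι v) (ι v')) : u = u' ∧ z = ι u := by
  have e1 : dist (ι u) z + dist z (ι v) = dist (ι u) (ι v) := hz
  have e2 : dist (ι u') z + dist z (ι v') = dist (ι u') (ι v') := hz'
  have t1 := dist_triangle (ι u) z (ι u')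
  have t2 := dist_triangle (ι v) z (ι v')
  rw [dist_comm z (ι u')] at t1
  rw [dist_comm (ι v) z] at t2
  have h2 : 2 ≤ dist (ι v) (ι v') := by
    obtain ⟨n, hn⟩ := hι.dist_eq_nat v v'
    rw [hn] at hfar ⊢
    have : 1 < n := by exact_mod_cast hfar
    exact_mod_cast this
  have p1 := dist_nonneg (x := ι u) (y := z)
  have p2 := dist_nonneg (x := ι u') (y := z)
  have hu : ι u = z := dist_eq_zero.1 (by linarith)
  have hu' : ι u' = z := dist_eq_zero.1 (by linarith)
  exact ⟨hι.injective (hu.trans hu'.symm), hu.symm⟩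

theorem common_vertex_or_dist_le (hι : IsGraphRealization K ι) {u v u' v' : W} {z : X}
    (huv : dist (ι u) (ι v) ≤ 1) (huv' : dist (ι u') (ι v') ≤ 1)
    (hz : z ∈ segBetween (ι u) (ι v)) (hz' : z ∈ segBetween (ι u') (ι v')) :
    (∃ c, (c = u ∨ c = v) ∧ (c = u' ∨ c = v') ∧ z = ι c) ∨
      (dist (ι u) (ι u') ≤ 1 ∧ dist (ι u) (ι v') ≤ 1 ∧
        dist (ι v) (ι u') ≤ 1 ∧ dist (ι v) (ι v') ≤ 1) := by
  have hvu : dist (ι v) (ι u) ≤ 1 := by rwa [dist_comm]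
  have hvu' : dist (ι v') (ι u') ≤ 1 := by rwa [dist_comm]
  have hzs : z ∈ segBetween (ι v) (ι u) := by rwa [segBetween_comm]
  have hzs' : z ∈ segBetween (ι v') (ι u') := by rwa [segBetween_comm]
  by_contra! hcon
  obtain ⟨hno, hall⟩ := hcon
  have hle : ∀ {a b a' b' : W}, (a = u ∨ a = v) → (a' = u' ∨ a' = v') →
      dist (ι a) (ι b) ≤ 1 → dist (ι a') (ι b') ≤ 1 → z ∈ segBetween (ι a) (ι b) →
      z ∈ segBetween (ι a') (ι b') → dist (ι b) (ι b') ≤ 1 := by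
    intro a b a' b' ha ha' hab hab' h h'
    by_contra! hfar
    obtain ⟨rfl, hza⟩ := hι.eq_of_one_lt_dist hab hab' h h' hfar
    exact hno a ha ha' hza
  refine absurd (hall ?_ ?_ ?_) (not_lt.2 ?_)
  · exact hle (Or.inr rfl) (Or.inr rfl) hvu hvu' hzs hzs'
  · exact hle (Or.inr rfl) (Or.inl rfl) hvu huv' hzs hz'
  · exact hle (Or.inl rfl) (Or.inr rfl) huv hvu' hz hzs'
  · exact hle (Or.inl rfl) (Or.inl rfl) huv huv' hz hz'

theorem eq_vertex_of_mem_segBetween (hι : IsGraphRealization K ι) {u v c : W}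
    (huv : dist (ι u) (ι v) ≤ 1) (hc : ι c ∈ segBetween (ι u) (ι v)) : c = u ∨ c = v := by
  have h : dist (ι u) (ι c) + dist (ι c) (ι v) = dist (ι u) (ι v) := hc
  rcases hι.dist_eq_zero_or_one (u := u) (v := c)
    (by linarith [dist_nonneg (x := ι c) (y := ι v)]) with h1 | h1
  · exact Or.inl h1.symm
  · right
    refine hι.injective (dist_eq_zero.1 (le_antisymm ?_ dist_nonneg))
    linarith

theorem spanPiece_inter_subsingleton (hι : IsGraphRealization K ι) (h : IsSideFunction K ε)
    {C D : Set W} (hC : IsFactorCoset K C) (hD : IsFactorCoset K D) (hne : C ≠ D) :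
    (spanPiece ι C ∩ spanPiece ι D).Subsingleton := by
  have hvert : ∀ z ∈ spanPiece ι C ∩ spanPiece ι D, ∃ c, c ∈ C ∧ c ∈ D ∧ z = ι c := by
    rintro z ⟨hzC, hzD⟩
    obtain ⟨u, hu, v, hv, huv, hz⟩ := hι.mem_spanPiece_iff.1 hzC
    obtain ⟨u', hu', v', hv', huv', hz'⟩ := hι.mem_spanPiece_iff.1 hzD
    rcases hι.common_vertex_or_dist_le huv huv' hz hz' with ⟨c, h1, h2, rfl⟩ | ⟨h1, h2, h3, h4⟩
    · exact ⟨c, by rcases h1 with rfl | rfl <;> assumption,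
        by rcases h2 with rfl | rfl <;> assumption, rfl⟩
    · by_cases huv1 : u = v
      · subst huv1
        obtain rfl := eq_of_mem_segBetween_self hz
        refine ⟨u, hu, ?_, rfl⟩
        rcases hι.eq_vertex_of_mem_segBetween huv' hz' with rfl | rfl <;> assumption
      by_cases huv2 : u' = v'
      · subst huv2
        obtain rfl := eq_of_mem_segBetween_self hz'
        refine ⟨u', ?_, hu', rfl⟩
        rcases hι.eq_vertex_of_mem_segBetween huv hz with rfl | rfl <;> assumption
      refine absurd (h.coset_eq hC hD huv2 ?_ ?_ hu' hv') hne
      · exact h.mem_coset_of_triangle hC hu hv huv1 (hι.mem_of_dist_le _ _ h1)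
          (hι.mem_of_dist_le _ _ h3)
      · exact h.mem_coset_of_triangle hC hu hv huv1 (hι.mem_of_dist_le _ _ h2)
          (hι.mem_of_dist_le _ _ h4)
  intro x hx y hy
  obtain ⟨c, hcC, hcD, rfl⟩ := hvert x hx
  obtain ⟨d, hdC, hdD, rfl⟩ := hvert y hy
  by_contra hxy
  exact hne (h.coset_eq hC hD (fun hcd => hxy (by rw [hcd])) hcC hdC hcD hdD)

theorem exists_mem_spanPiece (hι : IsGraphRealization K ι) (x : X) :
    ∃ C, IsFactorCoset K C ∧ x ∈ spanPiece ι C := by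
  obtain ⟨u, v, huv, hx⟩ := hι.cover x
  obtain ⟨b, hb⟩ := hι.mem_of_dist_le u v huv.le
  exact ⟨_, ⟨u, b, rfl⟩, Or.inr ⟨u, by simp, v, hb, huv, hx⟩⟩

theorem spanPiece_sideSet_union (hι : IsGraphRealization K ι) (h : IsSideFunction K ε) (w : W)
    (b : Bool) : spanPiece ι (sideSet ε w b) ∪ spanPiece ι (sideSet ε w (!b)) = univ := by
  refine eq_univ_of_forall fun x => ?_
  obtain ⟨u, v, huv, hx⟩ := hι.cover x
  have key : ∃ c, u ∈ sideSet ε w c ∧ v ∈ sideSet ε w c := by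
    by_cases hu : u = w
    · exact ⟨_, Or.inl hu, Or.inr rfl⟩
    by_cases hv : v = w
    · exact ⟨_, Or.inr rfl, Or.inl hv⟩
    exact ⟨_, Or.inr (h.side_eq (hι.mem_of_dist_le u v huv.le) hu hv), Or.inr rfl⟩
  obtain ⟨c, hu, hv⟩ := key
  have hxc : x ∈ spanPiece ι (sideSet ε w c) := Or.inr ⟨u, hu, v, hv, huv, hx⟩
  cases b <;> cases c <;> simp_all

theorem eq_of_mem_both_sides (hι : IsGraphRealization K ι) (h : IsSideFunction K ε) {w : W}
    {b : Bool} {z : X} (hz : z ∈ spanPiece ι (sideSet ε w b))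
    (hz' : z ∈ spanPiece ι (sideSet ε w (!b))) : z = ι w := by
  obtain ⟨u, hu, v, hv, huv, hzs⟩ := hι.mem_spanPiece_iff.1 hz
  obtain ⟨u', hu', v', hv', huv', hzs'⟩ := hι.mem_spanPiece_iff.1 hz'
  have hcommon : ∀ c, c ∈ sideSet ε w b → c ∈ sideSet ε w (!b) → c = w := by
    rintro c (hc | hc) (hc' | hc')
    · exact hc
    · exact hc
    · exact hc'
    · simp [hc] at hc'
  have hnear : ∀ c d, c ∈ sideSet ε w b → d ∈ sideSet ε w (!b) → dist (ι c) (ι d) ≤ 1 →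
      c = w ∨ d = w := by
    intro c d hc hd hcd
    by_contra! hne
    have := h.side_eq (hι.mem_of_dist_le c d hcd) hne.1 hne.2
    rw [hc.resolve_left hne.1, hd.resolve_left hne.2] at this
    simp at this
  rcases hι.common_vertex_or_dist_le huv huv' hzs hzs' with ⟨c, h1, h2, rfl⟩ | ⟨h1, h2, h3, h4⟩
  · rw [hcommon c (by rcases h1 with rfl | rfl <;> assumption)
      (by rcases h2 with rfl | rfl <;> assumption)]
  · rcases hnear u u' hu hu' h1 with rfl | rfl
    · rcases hnear v u' hv hu' h3 with rfl | rfl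
      · exact eq_of_mem_segBetween_self hzs
      · rcases hnear v v' hv hv' h4 with rfl | rfl
        · exact eq_of_mem_segBetween_self hzs
        · exact eq_of_mem_segBetween_self hzs'
    · rcases hnear u v' hu hv' h2 with rfl | rfl
      · rcases hnear v v' hv hv' h4 with rfl | rfl
        · exact eq_of_mem_segBetween_self hzs
        · exact eq_of_mem_segBetween_self hzs'
      · exact eq_of_mem_segBetween_self hzs'

/-- A point outside a piece is separated from the piece by a vertex of the piece. -/
theorem exists_cut (hι : IsGraphRealization K ι) (h : IsSideFunction K ε) {C : Set W}
    (hC : IsFactorCoset K C) {y : X} (hy : y ∉ spanPiece ι C) :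
    ∃ w ∈ C, ∃ A B : Set X, IsClosed A ∧ IsClosed B ∧ A ∪ B = univ ∧ (∀ z ∈ A ∩ B, z = ι w) ∧
      spanPiece ι C ⊆ A ∧ y ∈ B := by
  obtain ⟨p, q, hpq, hyseg⟩ := hι.cover y
  have hcut : ∃ w ∈ C, ∃ b, C ⊆ sideSet ε w b ∧ p ∈ sideSet ε w (!b) ∧
      q ∈ sideSet ε w (!b) := by
    by_cases hp : p ∈ C
    · have hq : q ∉ C := fun hq => hy (Or.inr ⟨p, hp, q, hq, hpq, hyseg⟩)
      obtain ⟨w, hw, b, h1, h2, h3⟩ :=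
        h.exists_separating hC hq (hι.mem_of_dist_le q p (by rw [dist_comm, hpq]))
      exact ⟨w, hw, b, h1, h3, h2⟩
    · exact h.exists_separating hC hp (hι.mem_of_dist_le p q hpq.le)
  obtain ⟨w, hw, b, hCb, hpb, hqb⟩ := hcut
  exact ⟨w, hw, _, _, hι.isClosed_spanPiece _, hι.isClosed_spanPiece _,
    hι.spanPiece_sideSet_union h w b, fun z hz => hι.eq_of_mem_both_sides h hz.1 hz.2,
    spanPiece_mono hCb, Or.inr ⟨p, hpb, q, hqb, hpq, hyseg⟩⟩

theorem isGeodesicSubset_spanPiece (hι : IsGraphRealization K ι) (h : IsSideFunction K ε)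
    (hgeo : GeodesicSpace X) {C : Set W} (hC : IsFactorCoset K C) :
    IsGeodesicSubset (spanPiece ι C) := by
  intro x hx y hy
  obtain ⟨γ, hγ, h0, h1⟩ := hgeo x y
  refine ⟨γ, hγ, h0, h1, fun t ht => ?_⟩
  by_contra hz
  obtain ⟨w, hw, A, B, hA, hB, hAB, hcap, hCA, hzB⟩ := hι.exists_cut h hC hz
  have hcont : ContinuousOn γ (Icc 0 (dist x y)) := by
    refine (LipschitzOnWith.of_dist_le_mul (K := 1) fun s hs t ht => ?_).continuousOn
    rw [hγ s hs t ht, Real.dist_eq]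
    simp
  have hmeet : ∀ J ⊆ Icc 0 (dist x y), IsPreconnected J → t ∈ J → (∃ s ∈ J, γ s ∈ A) →
      ∃ s ∈ J, γ s = ι w := by
    rintro J hJ hJc htJ ⟨s, hs, hsA⟩
    have hpre := hJc.image γ (hcont.mono hJ)
    obtain ⟨_, ⟨r, hr, rfl⟩, hrAB⟩ := isPreconnected_closed_iff.1 hpre A B hA hB
      (by rw [hAB]; exact subset_univ _) ⟨_, mem_image_of_mem γ hs, hsA⟩
      ⟨_, mem_image_of_mem γ htJ, hzB⟩
    exact ⟨r, hr, hcap _ hrAB⟩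
  obtain ⟨s₁, hs₁, e₁⟩ := hmeet (Icc 0 t) (Icc_subset_Icc_right ht.2) isPreconnected_Icc
    ⟨ht.1, le_rfl⟩ ⟨0, ⟨le_rfl, ht.1⟩, hCA (h0 ▸ hx)⟩
  obtain ⟨s₂, hs₂, e₂⟩ := hmeet (Icc t (dist x y)) (Icc_subset_Icc_left ht.1)
    isPreconnected_Icc ⟨le_rfl, ht.2⟩ ⟨dist x y, ⟨ht.2, le_rfl⟩, hCA (by rwa [h1])⟩
  have hd := hγ s₁ ⟨hs₁.1, hs₁.2.trans ht.2⟩ s₂ ⟨ht.1.trans hs₂.1, hs₂.2⟩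
  rw [e₁, e₂, dist_self, eq_comm, abs_eq_zero, sub_eq_zero] at hd
  have hst : s₁ = t := le_antisymm hs₁.2 (hd ▸ hs₂.1)
  refine hz ?_
  rw [← hst, e₁]
  exact mem_spanPiece_of_mem hw

end IsGraphRealization

theorem AddCircle.isPreconnected_compl_singleton (a : AddCircle (1 : ℝ)) :
    IsPreconnected ({a}ᶜ : Set (AddCircle (1 : ℝ))) := by
  have : Fact ((0 : ℝ) < 1) := ⟨one_pos⟩
  obtain ⟨r, rfl⟩ := QuotientAddGroup.mk_surjective a
  have h := (AddCircle.openPartialHomeomorphCoe (1 : ℝ) r).image_source_eq_target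
  simp only [AddCircle.openPartialHomeomorphCoe_source, AddCircle.openPartialHomeomorphCoe_target,
    AddCircle.openPartialHomeomorphCoe_apply] at h
  have := (isPreconnected_Ioo (a := r) (b := r + 1)).image
    ((↑) : ℝ → AddCircle (1 : ℝ)) (AddCircle.continuous_mk' 1).continuousOn
  rwa [h] at this

namespace IsGraphRealization

theorem exists_notMem_range_of_injective (hι : IsGraphRealization K ι)
    {loop : AddCircle (1 : ℝ) → X} (hcont : Continuous loop) (hinj : Function.Injective loop) :
    ∃ s, loop s ∉ range ι := by
  have : Fact ((0 : ℝ) < 1) := ⟨one_pos⟩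
  by_contra! hall
  obtain ⟨s, hs⟩ : ∃ s : AddCircle (1 : ℝ), s ≠ 0 :=
    ⟨((1 / 2 : ℝ) : AddCircle (1 : ℝ)), by
      rw [ne_eq, AddCircle.coe_eq_zero_iff_of_mem_Ico ⟨by norm_num, by norm_num⟩]
      norm_num⟩
  obtain ⟨p, hp⟩ := hall 0
  obtain ⟨q, hq⟩ := hall s
  obtain ⟨n, hn⟩ := hι.dist_eq_nat p q
  have hn0 : n ≠ 0 := by
    rintro rfl
    rw [hp, hq, Nat.cast_zero, dist_eq_zero] at hn
    exact hs (hinj hn).symm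
  have hn1 : (1 : ℝ) ≤ n := by exact_mod_cast Nat.one_le_iff_ne_zero.2 hn0
  have hf : Continuous fun t => dist (loop 0) (loop t) := by fun_prop
  obtain ⟨t, ht⟩ := mem_range_of_exists_le_of_exists_ge hf (c := 1 / 2) ⟨0, by simp⟩
    ⟨s, by rw [← hp, ← hq, hn]; linarith⟩
  obtain ⟨r, hr⟩ := hall t
  obtain ⟨m, hm⟩ := hι.dist_eq_nat p r
  rw [hp, hr] at hm
  have hm2 : (2 * m : ℝ) = 1 := by
    simp only at ht
    linarith
  have hm3 : 2 * m = 1 := by exact_mod_cast hm2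
  omega

theorem exists_range_subset_spanPiece (hι : IsGraphRealization K ι) (h : IsSideFunction K ε)
    {loop : AddCircle (1 : ℝ) → X} (hcont : Continuous loop) (hinj : Function.Injective loop) :
    ∃ C, IsFactorCoset K C ∧ range loop ⊆ spanPiece ι C := by
  obtain ⟨s, hs⟩ := hι.exists_notMem_range_of_injective hcont hinj
  obtain ⟨C, hC, hsC⟩ := hι.exists_mem_spanPiece (loop s)
  refine ⟨C, hC, ?_⟩
  rintro _ ⟨t, rfl⟩
  by_contra ht
  obtain ⟨w, hw, A, B, hA, hB, hAB, hcap, hCA, htB⟩ := hι.exists_cut h hC ht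
  have htw : loop t ≠ ι w := fun he => ht (he ▸ mem_spanPiece_of_mem hw)
  have hsw : loop s ≠ ι w := fun he => hs ⟨w, he.symm⟩
  have hpre : IsPreconnected {r | loop r ≠ ι w} := by
    by_cases hex : ∃ r, loop r = ι w
    · obtain ⟨r, hr⟩ := hex
      convert AddCircle.isPreconnected_compl_singleton r using 1
      ext r'
      simp [← hr, hinj.eq_iff]
    · push Not at hex
      rw [eq_univ_of_forall (s := {r | loop r ≠ ι w}) hex]
      exact isPreconnected_univ
  obtain ⟨r, hr, hrAB⟩ := isPreconnected_closed_iff.1 hpre _ _ (hA.preimage hcont)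
    (hB.preimage hcont) (by rw [← preimage_union, hAB]; exact subset_univ _)
    ⟨s, hsw, hCA hsC⟩ ⟨t, htw, htB⟩
  exact hr (hcap _ hrAB)

theorem isTreeGraded (hι : IsGraphRealization K ι) (h : IsSideFunction K ε)
    (hgeo : GeodesicSpace X) :
    IsTreeGraded X {P | ∃ C, IsFactorCoset K C ∧ P = spanPiece ι C} where
  nonempty := by
    rintro _ ⟨_, ⟨w, b, rfl⟩, rfl⟩
    exact ⟨ι w, mem_spanPiece_of_mem (by simp)⟩
  closed := by
    rintro _ ⟨C, -, rfl⟩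
    exact hι.isClosed_spanPiece C
  geodesicSub := by
    rintro _ ⟨C, hC, rfl⟩
    exact hι.isGeodesicSubset_spanPiece h hgeo hC
  covers x := by
    obtain ⟨C, hC, hx⟩ := hι.exists_mem_spanPiece x
    exact ⟨_, ⟨C, hC, rfl⟩, hx⟩
  t1 := by
    rintro _ ⟨C, hC, rfl⟩ _ ⟨D, hD, rfl⟩ hne
    exact hι.spanPiece_inter_subsingleton h hC hD fun he => hne (by rw [he])
  t2 loop hcont hinj := by
    obtain ⟨C, hC, hsub⟩ := hι.exists_range_subset_spanPiece h hcont hinj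
    exact ⟨_, ⟨C, hC, rfl⟩, hsub⟩

end IsGraphRealization

end Realization

theorem closure_inl_image_union_inr_image {G H : Type*} [Group G] [Group H] {S : Set G}
    {T : Set H} (hS : Subgroup.closure S = ⊤) (hT : Subgroup.closure T = ⊤) :
    Subgroup.closure ((⇑(Monoid.Coprod.inl : G →* Monoid.Coprod G H) '' S) ∪
      (⇑(Monoid.Coprod.inr : H →* Monoid.Coprod G H) '' T)) = ⊤ := by
  rw [Subgroup.closure_union, ← MonoidHom.map_closure, ← MonoidHom.map_closure, hS, hT,
    ← MonoidHom.range_eq_map, ← MonoidHom.range_eq_map, Monoid.Coprod.range_inl_sup_range_inr]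

/-- The Cayley graph of the free product `G ∗ H` with respect to the union of finite
generating sets `S` of `G` and `T` of `H` — realized as a complete geodesic metric
space `X` whose vertex set is `ι (G ∗ H)` with the word metric, every point of `X`
lying on a unit segment joining two adjacent vertices — is tree-graded with respect to
the collection of (realizations of the subgraphs spanned by) all left cosets `w·G` and
`w·H`. -/
theorem cayley_freeProduct_treeGraded (G H : Type*) [Group G] [Group H]
    (S : Set G) (T : Set H) (hSfin : S.Finite) (hTfin : T.Finite)
    (hSgen : Subgroup.closure S = ⊤) (hTgen : Subgroup.closure T = ⊤)
    (X : Type*) [MetricSpace X] [CompleteSpace X] (hgeo : GeodesicSpace X)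
    (ι : Monoid.Coprod G H → X)
    (hdist : ∀ u v : Monoid.Coprod G H,
      dist (ι u) (ι v) = wordDist
        ((⇑(Monoid.Coprod.inl : G →* Monoid.Coprod G H) '' S) ∪
          (⇑(Monoid.Coprod.inr : H →* Monoid.Coprod G H) '' T)) u v)
    (hcover : ∀ x : X, ∃ u v : Monoid.Coprod G H,
      wordDist ((⇑(Monoid.Coprod.inl : G →* Monoid.Coprod G H) '' S) ∪
          (⇑(Monoid.Coprod.inr : H →* Monoid.Coprod G H) '' T)) u v = 1 ∧
        x ∈ segBetween (ι u) (ι v)) :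
    IsTreeGraded X
      {P : Set X | ∃ w : Monoid.Coprod G H,
        P = cosetPiece ι
            (wordDist ((⇑(Monoid.Coprod.inl : G →* Monoid.Coprod G H) '' S) ∪
              (⇑(Monoid.Coprod.inr : H →* Monoid.Coprod G H) '' T)))
            ((w • Set.range ⇑(Monoid.Coprod.inl : G →* Monoid.Coprod G H) : Set (Monoid.Coprod G H))) ∨
        P = cosetPiece ι
            (wordDist ((⇑(Monoid.Coprod.inl : G →* Monoid.Coprod G H) '' S) ∪
              (⇑(Monoid.Coprod.inr : H →* Monoid.Coprod G H) '' T)))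
            ((w • Set.range ⇑(Monoid.Coprod.inr : H →* Monoid.Coprod G H) : Set (Monoid.Coprod G H)))} := by
  set A : Set (Monoid.Coprod G H) := (⇑(Monoid.Coprod.inl : G →* Monoid.Coprod G H) '' S) ∪
    (⇑(Monoid.Coprod.inr : H →* Monoid.Coprod G H) '' T) with hA
  have hgen : Subgroup.closure A = ⊤ := closure_inl_image_union_inr_image hSgen hTgen
  have hfin : A.Finite := (hSfin.image _).union (hTfin.image _)
  have hd : wordDist A = fun u v => dist (ι u) (ι v) := by
    ext u v
    exact (hdist u v).symm
  have hAfac : ∀ a ∈ A, ∃ b, a ∈ coprodFactor G H b := by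
    rintro _ (⟨g, -, rfl⟩ | ⟨k, -, rfl⟩)
    · exact ⟨true, g, rfl⟩
    · exact ⟨false, k, rfl⟩
  have hι : IsGraphRealization (coprodFactor G H) ι :=
    { dist_eq_nat := fun u v => ⟨_, hdist u v⟩
      injective := fun u v huv => by
        have h0 := hdist u v
        rw [huv, dist_self, wordDist, eq_comm, Nat.cast_eq_zero] at h0
        exact inv_mul_eq_one.1 (eq_one_of_wordLength_eq_zero hgen h0)
      mem_of_dist_le := fun u v huv => by
        rw [hdist, wordDist, Nat.cast_le_one] at huv
        rcases Nat.le_one_iff_eq_zero_or_eq_one.1 huv with h0 | h1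
        · exact ⟨true, by rw [eq_one_of_wordLength_eq_zero hgen h0]; exact one_mem _⟩
        · rcases mem_or_inv_mem_of_wordLength_eq_one hgen h1 with h2 | h2
          · exact hAfac _ h2
          · obtain ⟨b, hb⟩ := hAfac _ h2
            exact ⟨b, by simpa using inv_mem hb⟩
      finite_ball := fun w r => by
        refine ((finite_setOf_wordLength_le hgen hfin ⌊r⌋₊).image (w * ·)).subset fun u hu => ?_
        refine ⟨w⁻¹ * u, Nat.le_floor ?_, mul_inv_cancel_left w u⟩
        have hu' : dist (ι w) (ι u) ≤ r := hu
        rwa [hdist] at hu'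
      cover := fun x => by
        obtain ⟨u, v, huv, hx⟩ := hcover x
        exact ⟨u, v, (hdist u v).trans huv, hx⟩ }
  have hcoset : ∀ (w : Monoid.Coprod G H) (b : Bool),
      {x | w⁻¹ * x ∈ coprodFactor G H b} = w • (coprodFactor G H b : Set (Monoid.Coprod G H)) := by
    intro w b
    ext x
    rw [Set.mem_smul_set_iff_inv_smul_mem]
    rfl
  convert hι.isTreeGraded isSideFunction_coprodSide hgeo using 1
  ext P
  simp only [hd, mem_ofPred_eq]
  constructor
  · rintro ⟨w, hP | hP⟩
    · exact ⟨_, ⟨w, true, rfl⟩, by rw [hP, hcoset]; rfl⟩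
    · exact ⟨_, ⟨w, false, rfl⟩, by rw [hP, hcoset]; rfl⟩
  · rintro ⟨_, ⟨w, b, rfl⟩, rfl⟩
    rw [hcoset]
    cases b
    · exact ⟨w, Or.inr rfl⟩
    · exact ⟨w, Or.inl rfl⟩
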